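/- For i = 1,…,N let f_i : ℝⁿ × ℝᵐ → ℝⁿ be continuous with f_i(0,0) = 0 and h_i : ℝⁿ → ℝᵖ be continuous with h_i(0) = 0, and define the network map F : ℝ^{Nn} → ℝ^{Nn} by F(x)_i = f_i(x_i, u_i) with u = Hh(x), H ∈ ℝ^{Nm×Np}. Suppose each subsystem is (Q_i,S_i,R_i)-dissipative with a continuous positive definite storage function V_i : ℝⁿ → ℝ, that Q + SH + HᵀSᵀ + HᵀRH ≺ 0 where Q = diag(Q₁,…,Q_N), S = diag(S₁,…,S_N), R = diag(R₁,…,R_N), and that each subsystem is zero-state detectable: every sequence (ξ_k) with ξ_{k+1} = f_i(ξ_k, 0) and h_i(ξ_k) = 0 for all k satisfies ξ_k → 0. Then the origin of x⁺ = F(x) is asymptotically stable: it is stable (for every ε > 0 there exists δ > 0 such that ‖x₀‖ ≤ δ implies ‖F^{(k)}(x₀)‖ ≤ ε for all k), and there exists δ₀ > 0 such that ‖x₀‖ ≤ δ₀ implies F^{(k)}(x₀) → 0 as k → ∞. -/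

import Mathlib

open Matrix

/-- Block-diagonal matrix built from `N` blocks of size `a × b`. -/
def blkDiag {N a b : ℕ} (M : Fin N → Matrix (Fin a) (Fin b) ℝ) :
    Matrix (Fin N × Fin a) (Fin N × Fin b) ℝ :=
  Matrix.of fun x y => if x.1 = y.1 then M x.1 x.2 y.2 else 0

open Filter Topology

/-- Lyapunov stability in discrete time: a continuous positive definite `W` that does
not increase along `F` makes the origin stable. -/
theorem stable_of_lyapunov {E : Type*} [NormedAddCommGroup E] [ProperSpace E]
    {F : E → E} (hF : Continuous F) (hF0 : F 0 = 0) {W : E → ℝ} (hW : Continuous W)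
    (hW0 : W 0 = 0) (hWpos : ∀ x, x ≠ 0 → 0 < W x) (hdec : ∀ x, W (F x) ≤ W x)
    {ε : ℝ} (hε : 0 < ε) :
    ∃ δ > (0 : ℝ), ∀ x, ‖x‖ ≤ δ → ∀ k : ℕ, ‖F^[k] x‖ ≤ ε := by
  have hFε : ∀ᶠ x in 𝓝 (0 : E), ‖F x‖ < ε :=
    hF.norm.continuousAt.eventually_lt continuousAt_const (by simpa [hF0] using hε)
  obtain ⟨r₀, hr₀, hr₀F⟩ := Metric.eventually_nhds_iff.1 hFε
  obtain ⟨r, hr, hrr₀, hrε⟩ : ∃ r > 0, r < r₀ ∧ r ≤ ε :=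
    ⟨min (r₀ / 2) ε, by positivity, (min_le_left _ _).trans_lt (by linarith), min_le_right _ _⟩
  have hK : IsCompact (Metric.closedBall (0 : E) ε ∩ {x | r ≤ ‖x‖}) :=
    (isCompact_closedBall 0 ε).inter_right (isClosed_le continuous_const continuous_norm)
  obtain ⟨c, hc, hcK⟩ := hK.exists_forall_le' (a := 0) hW.continuousOn fun x hx =>
    hWpos x (norm_pos_iff.1 (hr.trans_le hx.2))
  have hWc : ∀ᶠ x in 𝓝 (0 : E), W x < c :=
    hW.continuousAt.eventually_lt continuousAt_const (by simpa [hW0] using hc)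
  obtain ⟨d, hd, hdW⟩ := Metric.eventually_nhds_iff.1 hWc
  refine ⟨min (d / 2) r, by positivity, fun x hx k => ?_⟩
  have key : ‖F^[k] x‖ ≤ r ∧ W (F^[k] x) < c := by
    induction k with
    | zero =>
      refine ⟨hx.trans (min_le_right _ _), hdW ?_⟩
      have := hx.trans (min_le_left _ _)
      rw [dist_zero_right]
      exact this.trans_lt (by linarith)
    | succ k ih =>
      rw [Function.iterate_succ_apply']
      have hlt : W (F (F^[k] x)) < c := (hdec _).trans_lt ih.2
      refine ⟨?_, hlt⟩
      by_contra! hgt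
      have hnorm : ‖F (F^[k] x)‖ < ε :=
        hr₀F (by rw [dist_zero_right]; exact ih.1.trans_lt hrr₀)
      exact (hcK _ ⟨by simpa using hnorm.le, hgt.le⟩).not_gt hlt
  exact key.1.trans hrε

/-- LaSalle's invariance principle for a bounded orbit: if every orbit along which `W` is constant
converges to the origin, so does every bounded orbit. -/
theorem tendsto_iterate_zero_of_lasalle {E : Type*} [NormedAddCommGroup E] [ProperSpace E]
    {F : E → E} (hF : Continuous F) {W : E → ℝ} (hW : Continuous W)
    (hW0 : W 0 = 0) (hWpos : ∀ x, x ≠ 0 → 0 < W x) (hdec : ∀ x, W (F x) ≤ W x)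
    (hinv : ∀ z, (∀ k : ℕ, W (F^[k] z) = W z) → Tendsto (fun k : ℕ => F^[k] z) atTop (𝓝 0))
    {x : E} {b : ℝ} (hb : ∀ k : ℕ, ‖F^[k] x‖ ≤ b) :
    Tendsto (fun k : ℕ => F^[k] x) atTop (𝓝 0) := by
  have hWnn : ∀ y, 0 ≤ W y := fun y => by
    rcases eq_or_ne y 0 with rfl | hy
    exacts [hW0.ge, (hWpos y hy).le]
  have hanti : Antitone fun k : ℕ => W (F^[k] x) := antitone_nat_of_succ_le fun k => by
    rw [Function.iterate_succ_apply']
    exact hdec _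
  obtain ⟨L, hL⟩ : ∃ L, Tendsto (fun k : ℕ => W (F^[k] x)) atTop (𝓝 L) :=
    ⟨_, tendsto_atTop_ciInf hanti ⟨0, by rintro _ ⟨k, rfl⟩; exact hWnn _⟩⟩
  refine (isCompact_closedBall (0 : E) b).tendsto_nhds_of_unique_mapClusterPt
    (Eventually.of_forall fun k => by simpa using hb k) fun z _ hz => ?_
  obtain ⟨φ, hφ, hφz⟩ := hz.tendsto_subseq
  have hconst : ∀ l : ℕ, W (F^[l] z) = L := fun l => by
    refine tendsto_nhds_unique (((hW.comp (hF.iterate l)).tendsto z).comp hφz) ?_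
    have hshift : Tendsto (fun j => l + φ j) atTop atTop :=
      tendsto_atTop_mono (fun j => Nat.le_add_left _ _) hφ.tendsto_atTop
    refine (hL.comp hshift).congr fun j => ?_
    simp only [Function.comp_apply, Function.iterate_add_apply]
  have hz0 := hinv z fun k => (hconst k).trans (hconst 0).symm
  have hL0 : L = 0 := by
    have hlim := (hW.tendsto 0).comp hz0
    rw [hW0] at hlim
    exact tendsto_nhds_unique (tendsto_const_nhds.congr fun k => (hconst k).symm) hlim
  by_contra hne
  exact (hWpos z hne).ne' ((hconst 0).trans hL0)

theorem blkDiag_mulVec_apply {N a b : ℕ} (M : Fin N → Matrix (Fin a) (Fin b) ℝ)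
    (v : Fin N × Fin b → ℝ) (i : Fin N) (c : Fin a) :
    (blkDiag M *ᵥ v) (i, c) = (M i *ᵥ fun d => v (i, d)) c := by
  simp [blkDiag, mulVec, dotProduct, Fintype.sum_prod_type, ite_mul]

theorem dotProduct_blkDiag_mulVec {N a b : ℕ} (M : Fin N → Matrix (Fin a) (Fin b) ℝ)
    (w : Fin N × Fin a → ℝ) (v : Fin N × Fin b → ℝ) :
    w ⬝ᵥ (blkDiag M *ᵥ v) = ∑ i, (fun c => w (i, c)) ⬝ᵥ (M i *ᵥ fun d => v (i, d)) := by
  simp only [dotProduct, Fintype.sum_prod_type, blkDiag_mulVec_apply]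

theorem dotProduct_closedLoop_mulVec {α β : Type*} [Fintype α] [Fintype β]
    (Q : Matrix α α ℝ) (S : Matrix α β ℝ) (R : Matrix β β ℝ) (H : Matrix β α ℝ) (y : α → ℝ) :
    y ⬝ᵥ ((Q + S * H + Hᵀ * Sᵀ + Hᵀ * R * H) *ᵥ y) =
      y ⬝ᵥ (Q *ᵥ y) + 2 * (y ⬝ᵥ (S *ᵥ (H *ᵥ y))) + (H *ᵥ y) ⬝ᵥ (R *ᵥ (H *ᵥ y)) := by
  have hS : y ⬝ᵥ (Hᵀ *ᵥ (Sᵀ *ᵥ y)) = y ⬝ᵥ (S *ᵥ (H *ᵥ y)) := by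
    rw [dotProduct_mulVec, vecMul_transpose, dotProduct_mulVec, vecMul_transpose, dotProduct_comm]
  have hR : y ⬝ᵥ (Hᵀ *ᵥ (R *ᵥ (H *ᵥ y))) = (H *ᵥ y) ⬝ᵥ (R *ᵥ (H *ᵥ y)) := by
    rw [dotProduct_mulVec, vecMul_transpose]
  simp only [add_mulVec, dotProduct_add, ← mulVec_mulVec, hS, hR]
  ring

/-- Interconnection of (Q_i,S_i,R_i)-dissipative, zero-state detectable nonlinear
discrete-time subsystems through `u = Hy`: if `Q + SH + HᵀSᵀ + HᵀRH ≺ 0`, the origin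
of the network `x⁺ = F(x)` is asymptotically stable. -/
theorem network_asymptotic_stability_nonlinear {N n m p : ℕ}
    (f : Fin N → (Fin n → ℝ) → (Fin m → ℝ) → (Fin n → ℝ))
    (hfc : ∀ i, Continuous fun q : (Fin n → ℝ) × (Fin m → ℝ) => f i q.1 q.2)
    (hf0 : ∀ i, f i 0 0 = 0)
    (h : Fin N → (Fin n → ℝ) → (Fin p → ℝ))
    (hhc : ∀ i, Continuous (h i)) (hh0 : ∀ i, h i 0 = 0)
    (H : Matrix (Fin N × Fin m) (Fin N × Fin p) ℝ)
    (F : (Fin N × Fin n → ℝ) → (Fin N × Fin n → ℝ))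
    (hF : ∀ (x : Fin N × Fin n → ℝ) (i : Fin N) (a : Fin n),
      F x (i, a) =
        f i (fun b => x (i, b))
          (fun c =>
            (H *ᵥ fun jp : Fin N × Fin p => h jp.1 (fun b => x (jp.1, b)) jp.2) (i, c)) a)
    (Q : Fin N → Matrix (Fin p) (Fin p) ℝ)
    (S : Fin N → Matrix (Fin p) (Fin m) ℝ)
    (R : Fin N → Matrix (Fin m) (Fin m) ℝ)
    (hQsymm : ∀ i, (Q i).IsSymm) (hRsymm : ∀ i, (R i).IsSymm)
    (V : Fin N → (Fin n → ℝ) → ℝ)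
    (hVc : ∀ i, Continuous (V i)) (hV0 : ∀ i, V i 0 = 0)
    (hVpos : ∀ i (ξ : Fin n → ℝ), ξ ≠ 0 → 0 < V i ξ)
    (hdiss : ∀ i (ξ : Fin n → ℝ) (v : Fin m → ℝ),
      V i (f i ξ v) - V i ξ ≤
        h i ξ ⬝ᵥ (Q i *ᵥ h i ξ) + 2 * (h i ξ ⬝ᵥ (S i *ᵥ v)) + v ⬝ᵥ (R i *ᵥ v))
    (hLMI : (-(blkDiag Q + blkDiag S * H + Hᵀ * (blkDiag S)ᵀ
        + Hᵀ * blkDiag R * H)).PosDef)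
    (hzsd : ∀ i, ∀ ξ : ℕ → (Fin n → ℝ),
      (∀ k, ξ (k + 1) = f i (ξ k) 0) → (∀ k, h i (ξ k) = 0) →
      Filter.Tendsto ξ Filter.atTop (nhds 0)) :
    (F 0 = 0 ∧
      ∀ ε > (0 : ℝ), ∃ δ > (0 : ℝ), ∀ x0 : Fin N × Fin n → ℝ,
        ‖x0‖ ≤ δ → ∀ k : ℕ, ‖F^[k] x0‖ ≤ ε) ∧
    ∃ δ₀ > (0 : ℝ), ∀ x0 : Fin N × Fin n → ℝ, ‖x0‖ ≤ δ₀ →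
      Filter.Tendsto (fun k : ℕ => F^[k] x0) Filter.atTop (nhds 0) := by
  set y : (Fin N × Fin n → ℝ) → (Fin N × Fin p → ℝ) :=
    fun x jp => h jp.1 (fun b => x (jp.1, b)) jp.2 with hy
  have hblk : ∀ i, Continuous fun (x : Fin N × Fin n → ℝ) (b : Fin n) => x (i, b) :=
    fun i => continuous_pi fun b => continuous_apply _
  have hyc : Continuous y := continuous_pi fun jp =>
    (continuous_apply jp.2).comp ((hhc jp.1).comp (hblk jp.1))
  have hFi : ∀ x i, (fun a => F x (i, a)) =
      f i (fun b => x (i, b)) (fun c => (H *ᵥ y x) (i, c)) :=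
    fun x i => funext fun a => hF x i a
  have hFc : Continuous F := by
    refine continuous_pi fun ia => ?_
    obtain ⟨i, a⟩ := ia
    simp only [hF]
    have hu : Continuous fun (x : Fin N × Fin n → ℝ) (c : Fin m) => (H *ᵥ y x) (i, c) :=
      continuous_pi fun c => (continuous_apply _).comp (continuous_const.matrix_mulVec hyc)
    exact (continuous_apply a).comp ((hfc i).comp ((hblk i).prodMk hu))
  have hy0 : y 0 = 0 := funext fun jp => congrFun (hh0 jp.1) jp.2
  have hF0 : F 0 = 0 := by
    funext ⟨i, a⟩
    have h0 := congrFun (hFi 0 i) a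
    rw [hy0, mulVec_zero] at h0
    exact h0.trans (congrFun (hf0 i) a)
  set W : (Fin N × Fin n → ℝ) → ℝ := fun x => ∑ i, V i fun b => x (i, b) with hWdef
  have hWc : Continuous W := continuous_finsetSum _ fun i _ => (hVc i).comp (hblk i)
  have hW0 : W 0 = 0 := Finset.sum_eq_zero fun i _ => hV0 i
  have hVnn : ∀ i ξ, 0 ≤ V i ξ := fun i ξ => by
    rcases eq_or_ne ξ 0 with rfl | hξ
    exacts [(hV0 i).ge, (hVpos i ξ hξ).le]
  have hWpos : ∀ x, x ≠ 0 → 0 < W x := fun x hx => by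
    obtain ⟨⟨i, a⟩, hia⟩ := Function.ne_iff.1 hx
    exact Finset.sum_pos' (fun j _ => hVnn j _)
      ⟨i, Finset.mem_univ i, hVpos i _ (Function.ne_iff.2 ⟨a, hia⟩)⟩
  have hdecQ : ∀ x, W (F x) - W x ≤ y x ⬝ᵥ ((blkDiag Q + blkDiag S * H + Hᵀ * (blkDiag S)ᵀ
      + Hᵀ * blkDiag R * H) *ᵥ y x) := fun x => by
    rw [dotProduct_closedLoop_mulVec]
    simp only [dotProduct_blkDiag_mulVec, Finset.mul_sum, ← Finset.sum_add_distrib, hWdef,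
      ← Finset.sum_sub_distrib]
    refine Finset.sum_le_sum fun i _ => ?_
    rw [hFi]
    exact hdiss i _ _
  have hstrict : ∀ x, y x ≠ 0 → W (F x) < W x := fun x hx => by
    have hpos := hLMI.dotProduct_mulVec_pos hx
    rw [star_trivial, neg_mulVec, dotProduct_neg] at hpos
    linarith [hdecQ x]
  have hdec : ∀ x, W (F x) ≤ W x := fun x => by
    by_cases hx : y x = 0
    · have hle := hdecQ x
      rw [hx, zero_dotProduct] at hle
      linarith
    · exact (hstrict x hx).le
  have hinv : ∀ z, (∀ k : ℕ, W (F^[k] z) = W z) →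
      Tendsto (fun k : ℕ => F^[k] z) atTop (𝓝 0) := fun z hz => by
    have hyk : ∀ k : ℕ, y (F^[k] z) = 0 := fun k => by
      by_contra hne
      have hlt := hstrict _ hne
      rw [← Function.iterate_succ_apply' F, hz, hz] at hlt
      exact hlt.false
    refine tendsto_pi_nhds.2 fun ia => ?_
    obtain ⟨i, a⟩ := ia
    refine tendsto_pi_nhds.1 (hzsd i (fun k b => (F^[k] z) (i, b)) (fun k => ?_) fun k => ?_) a
    · rw [Function.iterate_succ_apply', hFi, hyk, mulVec_zero]
      rfl
    · exact funext fun c => congrFun (hyk k) (i, c)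
  refine ⟨⟨hF0, fun ε hε => stable_of_lyapunov hFc hF0 hWc hW0 hWpos hdec hε⟩, ?_⟩
  obtain ⟨δ, hδ, hbound⟩ := stable_of_lyapunov hFc hF0 hWc hW0 hWpos hdec one_pos
  exact ⟨δ, hδ, fun x hx =>
    tendsto_iterate_zero_of_lasalle hFc hWc hW0 hWpos hdec hinv (hbound x hx)⟩
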